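/- Let T be a string of length n and let z be the number of phrases in the LZ77 parsing of T (the variant with no overlap between a phrase and its source). Then the set of the ending positions of the z phrases is a string attractor of T; in particular T has a string attractor of size z. -/

import Mathlib

universe u

variable {α : Type*}

/-- `substr T i j` is the 1-based substring `T[i..j]` of `T`. -/
def substr (T : List α) (i j : ℕ) : List α := (T.drop (i - 1)).take (j + 1 - i)

/-- `Γ` is a string attractor of `T` (positions are 1-based): every nonempty
substring `T[i..j]` has an occurrence `T[i'..j'] = T[i..j]` crossing a position of `Γ`. -/
def IsAttractor (T : List α) (Γ : Finset ℕ) : Prop :=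
  (∀ p ∈ Γ, 1 ≤ p ∧ p ≤ T.length) ∧
  ∀ i j : ℕ, 1 ≤ i → i ≤ j → j ≤ T.length →
    ∃ i' j' p : ℕ, 1 ≤ i' ∧ i' ≤ j' ∧ j' ≤ T.length ∧
      substr T i' j' = substr T i j ∧ p ∈ Γ ∧ i' ≤ p ∧ p ≤ j'

/-- Length of the greedy LZ77 phrase (non-overlapping variant) starting at the
1-based position `i`: the maximum of `1` and the largest `ℓ` such that
`T[i..i+ℓ-1]` has an occurrence `T[p..p+ℓ-1]` with `p+ℓ-1 < i`. -/
noncomputable def lzLen (T : List α) (i : ℕ) : ℕ :=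
  max 1 (sSup {ℓ : ℕ | ∃ p : ℕ, 1 ≤ p ∧ p + ℓ ≤ i ∧ i + ℓ ≤ T.length + 1 ∧
    substr T p (p + ℓ - 1) = substr T i (i + ℓ - 1)})

/-- Starting position of the `k`-th (0-based) phrase of the LZ77 parsing of `T`. -/
noncomputable def lzStart (T : List α) : ℕ → ℕ
  | 0 => 1
  | k + 1 => lzStart T k + lzLen T (lzStart T k)

/-- `z`: the number of phrases of the LZ77 parsing of `T`. -/
noncomputable def lzCount (T : List α) : ℕ := sInf {k : ℕ | lzStart T k = T.length + 1}

theorem lz_aux_bdd (T : List α) (i : ℕ) : BddAbove {ℓ : ℕ | ∃ p : ℕ, 1 ≤ p ∧ p + ℓ ≤ i ∧ i + ℓ ≤ T.length + 1 ∧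
    substr T p (p + ℓ - 1) = substr T i (i + ℓ - 1)} :=
  ⟨i, by rintro l ⟨p, h1, h2, -⟩; omega⟩

theorem lz_aux_len (T : List α) (i : ℕ) : lzLen T i = 1 ∨ ∃ p : ℕ, 1 ≤ p ∧ p + lzLen T i ≤ i ∧
    i + lzLen T i ≤ T.length + 1 ∧
    substr T p (p + lzLen T i - 1) = substr T i (i + lzLen T i - 1) := by
  by_cases h : lzLen T i = 1
  · exact Or.inl h
  · right
    have e : lzLen T i = sSup {ℓ : ℕ | ∃ p : ℕ, 1 ≤ p ∧ p + ℓ ≤ i ∧ i + ℓ ≤ T.length + 1 ∧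
        substr T p (p + ℓ - 1) = substr T i (i + ℓ - 1)} := by
      unfold lzLen at h ⊢
      omega
    have hne : {ℓ : ℕ | ∃ p : ℕ, 1 ≤ p ∧ p + ℓ ≤ i ∧ i + ℓ ≤ T.length + 1 ∧
        substr T p (p + ℓ - 1) = substr T i (i + ℓ - 1)}.Nonempty := by
      by_contra hc
      rw [Set.not_nonempty_iff_eq_empty] at hc
      unfold lzLen at h
      rw [hc] at h
      simp at h
    have := Nat.sSup_mem hne (lz_aux_bdd T i)
    rw [← e] at this
    exact this

theorem lz_aux_pos (T : List α) (i : ℕ) : 1 ≤ lzLen T i := le_max_left _ _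

theorem lz_aux_le (T : List α) (i : ℕ) (hi : i ≤ T.length) : i + lzLen T i ≤ T.length + 1 := by
  rcases lz_aux_len T i with h | ⟨p, _, _, h, _⟩ <;> omega

theorem lz_aux_mono (T : List α) : StrictMono (lzStart T) :=
  strictMono_nat_of_lt_succ (fun k => by
    have := lz_aux_pos T (lzStart T k)
    rw [lzStart]; omega)

theorem lz_aux_count (T : List α) : lzStart T (lzCount T) = T.length + 1 := by
  have : {k : ℕ | lzStart T k = T.length + 1}.Nonempty := by
    by_contra hc
    have h : ∀ k, lzStart T k ≠ T.length + 1 := fun k hk => hc ⟨k, hk⟩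
    have h2 : ∀ k, lzStart T k ≤ T.length := by
      intro k
      induction k with
      | zero => have := h 0; rw [lzStart] at *; omega
      | succ k ih =>
        have a := h (k + 1)
        have b := lz_aux_le T _ ih
        rw [lzStart] at *; omega
    have a := (lz_aux_mono T).id_le (T.length + 1)
    have b := h2 (T.length + 1)
    simp only [id] at a
    omega
  exact Nat.sInf_mem this

theorem lz_aux_sub (T : List α) (s p l i j : ℕ) (hp : 1 ≤ p) (hps : p ≤ s) (hsi : s ≤ i) (hij : i ≤ j)
    (hj : j < s + l) (h : substr T p (p + l - 1) = substr T s (s + l - 1)) :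
    substr T (i - (s - p)) (j - (s - p)) = substr T i j := by
  have h2 := congrArg (fun L => (L.drop (i - s)).take (j + 1 - i)) h
  simp only [substr, List.drop_take, List.drop_drop, List.take_take] at h2
  unfold substr
  convert h2 using 2 <;> first | omega | (congr 1; omega)

theorem lz_aux_find (T : List α) (i : ℕ) (hi : 1 ≤ i) (hn : i ≤ T.length) :
    ∃ k < lzCount T, lzStart T k ≤ i ∧ i < lzStart T (k + 1) := by
  have hex : ∃ k, i < lzStart T k := ⟨lzCount T, by rw [lz_aux_count]; omega⟩
  classical
  have h1 := Nat.find_spec hex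
  have h2 : Nat.find hex ≤ lzCount T := Nat.find_min' hex (by rw [lz_aux_count]; omega)
  have h3 := fun m => @Nat.find_min _ _ hex m
  generalize Nat.find hex = m at *
  cases m with
  | zero => rw [lzStart] at h1; omega
  | succ k => exact ⟨k, by omega, by have := h3 k (by omega); omega, h1⟩

theorem lz77_ends_attractor (T : List α) :
    IsAttractor T ((Finset.range (lzCount T)).image (fun k => lzStart T (k + 1) - 1)) ∧
    ((Finset.range (lzCount T)).image (fun k => lzStart T (k + 1) - 1)).card = lzCount T := by
  have hm := lz_aux_mono T
  have h1 : ∀ k, 1 ≤ lzStart T k := fun k => hm.monotone (Nat.zero_le k)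
  refine ⟨⟨?_, ?_⟩, ?_⟩
  · intro p hp
    simp only [Finset.mem_image, Finset.mem_range] at hp
    obtain ⟨k, hk, rfl⟩ := hp
    have a := hm.monotone (show k + 1 ≤ lzCount T from hk)
    have b := hm (Nat.lt_succ_self k)
    have c := h1 k
    rw [lz_aux_count] at a
    simp only [Nat.succ_eq_add_one] at b
    omega
  · intro i
    induction i using Nat.strong_induction_on with
    | _ i ih =>
      intro j hi hij hj
      obtain ⟨k, hk, hs, he⟩ := lz_aux_find T i hi (hij.trans hj)
      by_cases hc : lzStart T (k + 1) - 1 ≤ j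
      · exact ⟨i, j, lzStart T (k + 1) - 1, hi, hij, hj, rfl,
          Finset.mem_image.2 ⟨k, Finset.mem_range.2 hk, rfl⟩, by omega, hc⟩
      · rw [lzStart] at he hc
        rcases lz_aux_len T (lzStart T k) with h | ⟨p, hp, hpl, _, hsub⟩
        · omega
        · have hpos := lz_aux_pos T (lzStart T k)
          have e := lz_aux_sub T (lzStart T k) p _ i j hp (by omega) hs hij (by omega) hsub
          obtain ⟨i', j', q, a1, a2, a3, a4, a5⟩ :=
            ih (i - (lzStart T k - p)) (by omega) (j - (lzStart T k - p)) (by omega) (by omega) (by omega)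
          exact ⟨i', j', q, a1, a2, a3, a4.trans e, a5⟩
  · rw [Finset.card_image_of_injective, Finset.card_range]
    intro a b hab
    have ha := h1 (a + 1)
    have hb := h1 (b + 1)
    simp only at hab
    have := hm.injective (show lzStart T (a + 1) = lzStart T (b + 1) by omega)
    omega
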